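/- Let ξ = (Γ, B, ν̄, c₁,…,c_b, c₁′,…,c_b′, α₁,…,α_k) be theta data, let V ⊆ Γ⊗ℚ be a linear subspace which contains c₁,…,c_b and c₁′,…,c_b′, and let T ⊆ {1,…,b} be a subset. Then for every τ in the upper half plane the series Σ over ν ∈ (ν̄ + Γ) ∩ V with B(ν,c_i) = 0 for all i ∈ T, of ∏_{i∉T}(sgn(B(c_i,ν)) − sgn(B(c_i′,ν))) · ∏_{j=1}^{k} B(α_j,ν) · e^{2πi Q(ν) τ}, converges absolutely, and the resulting function of τ is an element of the algebra 𝓜. -/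

import Mathlib

open scoped BigOperators

/-- The ℚ-bilinear pairing on `Fin n → ℚ` induced by an integer matrix,
representing a symmetric bilinear form `B : Γ × Γ → ℤ` on the finitely generated
free abelian group `Γ = ℤ^n`, extended ℚ-bilinearly to `Γ ⊗ ℚ = ℚ^n`. -/
def intPair {n : ℕ} (M : Matrix (Fin n) (Fin n) ℤ) (x y : Fin n → ℚ) : ℚ :=
  ∑ i, ∑ j, (M i j : ℚ) * x i * y j

/-- The sign function: `sgn x = x / |x|` for `x ≠ 0` and `sgn 0 = 0`. -/
def sgn (x : ℚ) : ℚ := if 0 < x then 1 else if x < 0 then -1 else 0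

/-- Raw theta data `ξ = (Γ, B, ν̄, c₁,…,c_b, c₁′,…,c_b′, α₁,…,α_k)`, with
`Γ = ℤ^n` and `B` given by the integer matrix `M`. -/
structure ThetaData where
  n : ℕ
  b : ℕ
  k : ℕ
  M : Matrix (Fin n) (Fin n) ℤ
  c : Fin b → Fin n → ℚ
  c' : Fin b → Fin n → ℚ
  nubar : Fin n → ℚ
  alpha : Fin k → Fin n → ℚ

namespace ThetaData

/-- The element `ν̄ + g` of the coset `ν̄ + Γ ⊆ Γ ⊗ ℚ`. -/
def nu (ξ : ThetaData) (g : Fin ξ.n → ℤ) : Fin ξ.n → ℚ :=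
  ξ.nubar + fun t => (g t : ℚ)

/-- Conditions (i)–(v) on theta data:
(i) `B` is a non-degenerate symmetric bilinear form whose real (equivalently,
rational) extension has signature `(a, b)` with `a = n - b ≥ b` (expressed by
non-degeneracy together with a positive definite subspace of dimension `n - b`,
and the negative definite `b`-dimensional subspace from (ii));
(ii) `c₁,…,c_b` span a `b`-dimensional negative definite subspace;
(iii) the orthogonality conditions on `c_i, c_j′`;
(iv) `B(c_i′, ν) ≠ 0` for all `ν ∈ ν̄ + Γ`;
(v) is automatic. -/
def IsThetaData (ξ : ThetaData) : Prop :=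
  2 * ξ.b ≤ ξ.n ∧
  ξ.M.IsSymm ∧
  (∀ x : Fin ξ.n → ℚ, (∀ y, intPair ξ.M x y = 0) → x = 0) ∧
  (∃ P : Submodule ℚ (Fin ξ.n → ℚ), Module.finrank ℚ P = ξ.n - ξ.b ∧
    ∀ v ∈ P, v ≠ 0 → 0 < intPair ξ.M v v) ∧
  Module.finrank ℚ (Submodule.span ℚ (Set.range ξ.c)) = ξ.b ∧
  (∀ v ∈ Submodule.span ℚ (Set.range ξ.c), v ≠ 0 → intPair ξ.M v v < 0) ∧
  (∀ i j, i ≠ j → intPair ξ.M (ξ.c i) (ξ.c' j) = 0) ∧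
  (∀ i j, intPair ξ.M (ξ.c' i) (ξ.c' j) = 0) ∧
  (∀ i, intPair ξ.M (ξ.c i) (ξ.c' i) < 0) ∧
  (∀ i (g : Fin ξ.n → ℤ), intPair ξ.M (ξ.c' i) (ξ.nu g) ≠ 0)

/-- The term of the theta series `Θ_ξ` indexed by `ν = ν̄ + g ∈ ν̄ + Γ`:
`∏_{i=1}^{b} (sgn(B(c_i,ν)) − sgn(B(c_i′,ν))) ∏_{j=1}^{k} B(α_j,ν) e^{2πi Q(ν) τ}`,
where `Q(ν) = B(ν,ν)/2`. -/
noncomputable def term (ξ : ThetaData) (τ : ℂ) (g : Fin ξ.n → ℤ) : ℂ :=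
  (((∏ i, (sgn (intPair ξ.M (ξ.c i) (ξ.nu g)) - sgn (intPair ξ.M (ξ.c' i) (ξ.nu g)))) *
      ∏ j, intPair ξ.M (ξ.alpha j) (ξ.nu g) : ℚ) : ℂ) *
    Complex.exp (2 * (Real.pi : ℂ) * Complex.I *
      ((intPair ξ.M (ξ.nu g) (ξ.nu g) / 2 : ℚ) : ℂ) * τ)

/-- The theta series `Θ_ξ(τ)`. -/
noncomputable def Theta (ξ : ThetaData) (τ : ℂ) : ℂ :=
  ∑' g : Fin ξ.n → ℤ, ξ.term τ g

end ThetaData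

open UpperHalfPlane in
/-- The ℚ-subalgebra `𝓜` of the ℂ-valued functions on the upper half plane generated
by the functions `τ ↦ Θ_ξ(τ/N)` for all theta data `ξ` and integers `N ≥ 1`. -/
noncomputable def MM : Subalgebra ℚ (UpperHalfPlane → ℂ) :=
  Algebra.adjoin ℚ {f | ∃ (ξ : ThetaData) (N : ℕ), ξ.IsThetaData ∧ 1 ≤ N ∧
    f = fun τ : UpperHalfPlane => ξ.Theta ((τ : ℂ) / N)}

open scoped Classical in
/-- The term, indexed by `ν = ν̄ + g`, of the restricted theta series of
Lemma 2.12: the sum ranges over `ν ∈ (ν̄ + Γ) ∩ V` with `B(ν, c_i) = 0` for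
`i ∈ T`, with terms
`∏_{i ∉ T}(sgn(B(c_i,ν)) − sgn(B(c_i′,ν))) ∏_j B(α_j,ν) e^{2πi Q(ν) τ}`. -/
noncomputable def ThetaData.restrictedTerm (ξ : ThetaData)
    (V : Submodule ℚ (Fin ξ.n → ℚ)) (T : Finset (Fin ξ.b)) (τ : ℂ)
    (g : Fin ξ.n → ℤ) : ℂ :=
  if ξ.nu g ∈ V ∧ ∀ i ∈ T, intPair ξ.M (ξ.nu g) (ξ.c i) = 0 then
    (((∏ i ∈ Tᶜ, (sgn (intPair ξ.M (ξ.c i) (ξ.nu g)) -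
          sgn (intPair ξ.M (ξ.c' i) (ξ.nu g)))) *
        ∏ j, intPair ξ.M (ξ.alpha j) (ξ.nu g) : ℚ) : ℂ) *
      Complex.exp (2 * (Real.pi : ℂ) * Complex.I *
        ((intPair ξ.M (ξ.nu g) (ξ.nu g) / 2 : ℚ) : ℂ) * τ)
  else 0

open LinearMap (BilinForm)

/-- The rational bilinear form underlying `intPair`. -/
noncomputable def intForm {n : ℕ} (M : Matrix (Fin n) (Fin n) ℤ) : BilinForm ℚ (Fin n → ℚ) :=
  Matrix.toBilin' (M.map (Int.cast : ℤ → ℚ))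

theorem intPair_eq_intForm {n : ℕ} (M : Matrix (Fin n) (Fin n) ℤ) (x y : Fin n → ℚ) :
    intPair M x y = intForm M x y := by
  simp only [intPair, intForm, Matrix.toBilin'_apply, Matrix.map_apply]
  exact Finset.sum_congr rfl fun i _ => Finset.sum_congr rfl fun j _ => by ring

theorem intForm_isSymm {n : ℕ} {M : Matrix (Fin n) (Fin n) ℤ} (hM : M.IsSymm) :
    (intForm M).IsSymm :=
  Matrix.isSymm_toBilin'_iff_isSymm.2 (hM.map _)

theorem isSymm_of_intForm {n : ℕ} {M : Matrix (Fin n) (Fin n) ℤ} (hM : (intForm M).IsSymm) :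
    M.IsSymm := by
  have h := Matrix.isSymm_toBilin'_iff_isSymm.1 hM
  ext i j
  have := congrFun (congrFun h i) j
  simpa using this

/-- The linear-algebraic part of theta data on a rational quadratic space `E`: the vectors `c i`
span a maximal negative definite subspace, and the `c' i` are isotropic and dual to the `c i`
up to negative scalars. -/
structure IsThetaFrame {E ι : Type*} [AddCommGroup E] [Module ℚ E] (B : BilinForm ℚ E)
    (c c' : ι → E) : Prop where
  symm : B.IsSymm
  pos : ∀ z, (∀ i, B (c i) z = 0) → z ≠ 0 → 0 < B z z
  neg : ∀ v ∈ Submodule.span ℚ (Set.range c), v ≠ 0 → B v v < 0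
  ortho : ∀ i j, i ≠ j → B (c i) (c' j) = 0
  isotropic : ∀ i j, B (c' i) (c' j) = 0
  pairing_neg : ∀ i, B (c i) (c' i) < 0

section ThetaFrame

variable {E ι : Type*} [AddCommGroup E] [Module ℚ E] {B : BilinForm ℚ E}

theorem forall_mem_span_range_of_apply_eq_zero {c : ι → E} {z : E} (h : ∀ i, B (c i) z = 0) :
    ∀ s ∈ Submodule.span ℚ (Set.range c), B s z = 0 := by
  intro s hs
  have hle : Submodule.span ℚ (Set.range c) ≤ LinearMap.ker (B.flip z) :=
    Submodule.span_le.2 (by rintro _ ⟨i, rfl⟩; exact h i)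
  exact hle hs

/-- Orthogonal projection onto a subspace without nonzero isotropic vectors. -/
theorem exists_mem_forall_apply_sub_eq_zero [FiniteDimensional ℚ E]
    (hB : B.IsSymm) {S : Submodule ℚ E}
    (hS : ∀ s ∈ S, B s s = 0 → s = 0) (x : E) :
    ∃ s ∈ S, ∀ t ∈ S, B t (x - s) = 0 := by
  have hdis : Disjoint S (B.orthogonal S) := by
    rw [Submodule.disjoint_def]
    exact fun s hs hs' => hS s hs (hs' s hs)
  have hc := (BilinForm.isCompl_orthogonal_iff_disjoint hB.isRefl).2 hdis
  obtain ⟨s, hs, t, ht, hst⟩ := Submodule.mem_sup.1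
    (hc.codisjoint.eq_top ▸ Submodule.mem_top : x ∈ S ⊔ B.orthogonal S)
  refine ⟨s, hs, fun u hu => ?_⟩
  rw [← hst, add_sub_cancel_left]
  exact ht u hu

/-- A subspace of complementary dimension on which a form is positive definite forces the form to
be positive definite on the orthogonal complement of a negative definite subspace. -/
theorem pos_of_orthogonal_of_finrank [FiniteDimensional ℚ E] {N P : Submodule ℚ E}
    (hB : B.IsSymm)
    (hN : ∀ v ∈ N, v ≠ 0 → B v v < 0) (hP : ∀ v ∈ P, v ≠ 0 → 0 < B v v)
    (hdim : Module.finrank ℚ E ≤ Module.finrank ℚ N + Module.finrank ℚ P)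
    {z : E} (hz : ∀ s ∈ N, B s z = 0) (hz0 : z ≠ 0) : 0 < B z z := by
  by_contra! hle
  have hzN : z ∉ N := fun h => (hN z h hz0).ne (hz z h)
  have hlt : N < N ⊔ Submodule.span ℚ {z} :=
    lt_of_le_of_ne le_sup_left fun h => hzN (h ▸
      Submodule.mem_sup_right (Submodule.mem_span_singleton_self z))
  have hdis : Disjoint (N ⊔ Submodule.span ℚ {z}) P := by
    rw [Submodule.disjoint_def]
    intro v hv hvP
    by_contra hv0
    obtain ⟨s, hs, t, ht, rfl⟩ := Submodule.mem_sup.1 hv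
    obtain ⟨r, rfl⟩ := Submodule.mem_span_singleton.1 ht
    have h1 := hP _ hvP hv0
    have h2 : B s s ≤ 0 := by
      by_cases h : s = 0
      · simp [h]
      · exact (hN s hs h).le
    have h3 : B z s = 0 := by rw [← hB.eq]; exact hz s hs
    simp only [map_add, map_smul, LinearMap.add_apply, LinearMap.smul_apply, smul_eq_mul,
      hz s hs, h3] at h1
    nlinarith [mul_self_nonneg r, mul_nonneg (mul_self_nonneg r) (neg_nonneg.2 hle)]
  have h1 := Submodule.finrank_add_finrank_le_of_disjoint hdis
  have h2 := Submodule.finrank_lt_finrank_of_lt hlt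
  omega

/-- On a positive definite subspace every linear functional is bounded. -/
theorem exists_sq_apply_le [FiniteDimensional ℚ E] {S : Submodule ℚ E} (hB : B.IsSymm)
    (hS : ∀ s ∈ S, s ≠ 0 → 0 < B s s) (f : E →ₗ[ℚ] ℚ) :
    ∃ C : ℚ, 0 ≤ C ∧ ∀ s ∈ S, f s ^ 2 ≤ C * B s s := by
  have hS' : ∀ s : S, 0 ≤ B.restrict S s s := by
    intro s
    by_cases h : (s : E) = 0
    · simp [h]
    · exact (hS s s.2 h).le
  have hsymm : LinearMap.IsSymm (B.restrict S) := ⟨fun x y => hB.eq x y⟩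
  have hnd : (B.restrict S).Nondegenerate := by
    refine BilinForm.nondegenerate_restrict_of_disjoint_orthogonal B hB.isRefl ?_
    rw [Submodule.disjoint_def]
    intro s hs hs'
    by_contra h
    exact (hS s hs h).ne' (hs' s hs)
  let a := ((B.restrict S).toDual hnd).symm (f.comp S.subtype)
  refine ⟨B.restrict S a a, hS' a, fun s hs => ?_⟩
  have h := BilinForm.apply_sq_le_of_symm (B.restrict S) hS' hsymm a ⟨s, hs⟩
  rwa [BilinForm.apply_toDual_symm_apply] at h

namespace IsThetaFrame

variable {c c' : ι → E}

theorem anisotropic (h : IsThetaFrame B c c') {v : E}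
    (hv : v ∈ Submodule.span ℚ (Set.range c)) (hv0 : B v v = 0) : v = 0 := by
  by_contra hne
  exact (h.neg v hv hne).ne hv0

theorem nondegenerate (h : IsThetaFrame B c c') {x : E} (hx : ∀ y, B x y = 0) : x = 0 := by
  by_contra hne
  exact (h.pos x (fun i => by rw [← h.symm.eq]; exact hx _) hne).ne' (hx x)

theorem linearIndependent_left (h : IsThetaFrame B c c') : LinearIndependent ℚ c := by
  classical
  rw [linearIndependent_iff']
  intro s g hg i hi
  have h1 := congrArg (fun v => B v (c' i)) hg
  simp only [map_sum, LinearMap.sum_apply, map_smul, LinearMap.smul_apply, smul_eq_mul,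
    map_zero, LinearMap.zero_apply] at h1
  rw [Finset.sum_eq_single i (fun j _ hj => by rw [h.ortho j i hj, mul_zero])
    (fun h => absurd hi h)] at h1
  exact (mul_eq_zero.1 h1).resolve_right (h.pairing_neg i).ne

theorem linearIndependent_right (h : IsThetaFrame B c c') : LinearIndependent ℚ c' := by
  classical
  rw [linearIndependent_iff']
  intro s g hg i hi
  have h1 := congrArg (fun v => B (c i) v) hg
  simp only [map_sum, map_smul, smul_eq_mul, map_zero] at h1
  rw [Finset.sum_eq_single i (fun j _ hj => by rw [h.ortho i j (Ne.symm hj), mul_zero])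
    (fun h => absurd hi h)] at h1
  exact (mul_eq_zero.1 h1).resolve_right (h.pairing_neg i).ne

theorem isotropic_span (h : IsThetaFrame B c c') {v : E}
    (hv : v ∈ Submodule.span ℚ (Set.range c')) : B v v = 0 :=
  forall_mem_span_range_of_apply_eq_zero (fun i => by
    rw [← h.symm.eq]
    exact forall_mem_span_range_of_apply_eq_zero (fun j => h.isotropic j i) v hv) v hv

theorem two_mul_card_le [Fintype ι] [FiniteDimensional ℚ E] (h : IsThetaFrame B c c') :
    2 * Fintype.card ι ≤ Module.finrank ℚ E := by
  have hdis : Disjoint (Submodule.span ℚ (Set.range c)) (Submodule.span ℚ (Set.range c')) := by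
    rw [Submodule.disjoint_def]
    exact fun v hv hv' => h.anisotropic hv (h.isotropic_span hv')
  have := Submodule.finrank_add_finrank_le_of_disjoint hdis
  rw [finrank_span_eq_card h.linearIndependent_left,
    finrank_span_eq_card h.linearIndependent_right] at this
  omega

theorem exists_pos_subspace [Fintype ι] [FiniteDimensional ℚ E] (h : IsThetaFrame B c c') :
    ∃ P : Submodule ℚ E, Module.finrank ℚ P = Module.finrank ℚ E - Fintype.card ι ∧
      ∀ v ∈ P, v ≠ 0 → 0 < B v v := by
  refine ⟨B.orthogonal (Submodule.span ℚ (Set.range c)), ?_, fun v hv =>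
    h.pos v fun i => hv _ (Submodule.subset_span ⟨i, rfl⟩)⟩
  rw [BilinForm.finrank_orthogonal (.ofSeparatingLeft fun x hx => h.nondegenerate hx),
    finrank_span_eq_card h.linearIndependent_left]

/-- On the cone where `B (c i) ν` and `B (c' i) ν` have opposite signs, and away from the
hyperplanes `B (c' i) ν = 0`, the quadratic form dominates every linear functional. -/
theorem exists_abs_apply_le [FiniteDimensional ℚ E] [Fintype ι] (h : IsThetaFrame B c c')
    (K : ι → ℚ) (f : E →ₗ[ℚ] ℚ) :
    ∃ C : ℚ, 0 ≤ C ∧ ∀ ν, (∀ i, B (c i) ν * B (c' i) ν ≤ 0) → (∀ i, 1 ≤ K i * |B (c' i) ν|) →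
      0 ≤ B ν ν ∧ |f ν| ≤ C * (1 + B ν ν) := by
  classical
  let S := Submodule.span ℚ (Set.range c)
  let d : ι → ℚ := fun i => B (c i) (c' i)
  have hd : ∀ i, d i < 0 := h.pairing_neg
  obtain ⟨C₁, hC₁, hb₁⟩ := exists_sq_apply_le (S := B.orthogonal S) h.symm
    (fun v hv => h.pos v fun i => hv _ (Submodule.subset_span ⟨i, rfl⟩)) f
  let k : E →ₗ[ℚ] ℚ := f - ∑ i, (f (c' i) / d i) • B (c i)
  obtain ⟨C₂, hC₂, hb₂⟩ := exists_sq_apply_le (B := -B) (S := S)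
    ⟨fun x y => congrArg Neg.neg (h.symm.eq x y)⟩
    (fun v hv hv0 => neg_pos.2 (h.neg v hv hv0)) k
  let C₃ : ℚ := ∑ i, |f (c' i)| * |K i|
  have hC₃ : 0 ≤ C₃ := Finset.sum_nonneg fun i _ => by positivity
  refine ⟨2 + C₁ + C₂ + C₃, by positivity, fun ν hν hK => ?_⟩
  let x : ι → ℚ := fun i => B (c i) ν
  let y : ι → ℚ := fun i => B (c' i) ν
  let u : E := ∑ i, (y i / d i) • c i
  let v : ι → ℚ := fun i => (x i - B (c i) u) / d i
  let w : E := ∑ i, v i • c' i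
  let p : E := ν - u - w
  have hu : u ∈ S := Submodule.sum_mem _ fun i _ =>
    Submodule.smul_mem _ _ (Submodule.subset_span ⟨i, rfl⟩)
  have hcw : ∀ i, B (c i) w = x i - B (c i) u := by
    intro i
    simp only [w, map_sum, map_smul, smul_eq_mul]
    rw [Finset.sum_eq_single i (fun j _ hj => by rw [h.ortho i j (Ne.symm hj), mul_zero])
      (fun hi => absurd (Finset.mem_univ i) hi)]
    exact div_mul_cancel₀ _ (hd i).ne
  have hc'u : ∀ i, B (c' i) u = y i := by
    intro i
    simp only [u, map_sum, map_smul, smul_eq_mul]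
    rw [Finset.sum_eq_single i
      (fun j _ hj => by rw [← h.symm.eq (c j)]; simp [h.ortho j i hj])
      (fun hi => absurd (Finset.mem_univ i) hi), ← h.symm.eq (c i)]
    exact div_mul_cancel₀ _ (hd i).ne
  have hc'w : ∀ i, B (c' i) w = 0 := by
    intro i
    simp [w, h.isotropic]
  have hcp : ∀ i, B (c i) p = 0 := by
    intro i
    simp only [p, map_sub, hcw]
    ring
  have hc'p : ∀ i, B (c' i) p = 0 := by
    intro i
    simp only [p, map_sub, hc'w, hc'u]
    simp [y]
  have hSp : ∀ s ∈ S, B s p = 0 := forall_mem_span_range_of_apply_eq_zero hcp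
  have hwp : B w p = 0 := by simp [w, hc'p]
  have hww : B w w = 0 := by
    conv_lhs => enter [1, 2]; simp only [w]
    simp [hc'w]
  have huν : B u ν = ∑ i, x i * y i / d i := by
    simp only [u, map_sum, map_smul, LinearMap.sum_apply, LinearMap.smul_apply, smul_eq_mul]
    exact Finset.sum_congr rfl fun i _ => by simp only [x]; ring
  have hνdec : ν = p + u + w := by simp only [p]; abel
  have hpu := hSp u hu
  have hsymm : ∀ a b, B a b = B b a := fun a b => h.symm.eq a b
  have hquad : B ν ν = B p p + 2 * ∑ i, x i * y i / d i - B u u := by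
    rw [← huν, hνdec]
    simp only [map_add, LinearMap.add_apply, hpu, hwp, hww, hsymm p u, hsymm p w, hsymm w u]
    ring
  have hterm : ∀ i, 0 ≤ x i * y i / d i := fun i =>
    div_nonneg_of_nonpos (hν i) (hd i).le
  have hsum : 0 ≤ ∑ i, x i * y i / d i := Finset.sum_nonneg fun i _ => hterm i
  have hpp : 0 ≤ B p p := by
    by_cases hp0 : p = 0
    · simp [hp0]
    · exact (h.pos p hcp hp0).le
  have huu : B u u ≤ 0 := by
    by_cases hu0 : u = 0
    · simp [hu0]
    · exact (h.neg u hu hu0).le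
  have hQ : 0 ≤ B ν ν := by rw [hquad]; linarith
  refine ⟨hQ, ?_⟩
  have hf : f ν = f p + k u + ∑ i, x i * f (c' i) / d i := by
    have hfw : f w = ∑ i, v i * f (c' i) := by simp [w]
    have hku : k u = f u - ∑ i, f (c' i) / d i * B (c i) u := by simp [k]
    rw [hku]
    conv_lhs => rw [hνdec]
    rw [map_add, map_add, hfw, sub_eq_add_neg, ← Finset.sum_neg_distrib, add_assoc, add_assoc,
      add_assoc, ← Finset.sum_add_distrib]
    congr 2
    exact Finset.sum_congr rfl fun i _ => by simp only [v]; ring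
  have e₁ : |f p| ≤ 1 + C₁ * B p p := by
    have := hb₁ p hSp
    rw [← sq_abs] at this
    nlinarith [sq_nonneg (|f p| - 1), abs_nonneg (f p)]
  have e₂ : |k u| ≤ 1 + C₂ * (-B u u) := by
    have : k u ^ 2 ≤ C₂ * (-B u u) := hb₂ u hu
    rw [← sq_abs] at this
    nlinarith [sq_nonneg (|k u| - 1), abs_nonneg (k u)]
  have e₃ : |∑ i, x i * f (c' i) / d i| ≤ C₃ * ∑ i, x i * y i / d i := by
    refine (Finset.abs_sum_le_sum_abs _ _).trans ?_
    rw [Finset.sum_mul]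
    refine Finset.sum_le_sum fun i _ => ?_
    calc |x i * f (c' i) / d i| = |f (c' i)| * (|x i / d i| * 1) := by
          rw [← abs_one, ← abs_mul, ← abs_mul]; congr 1; ring
      _ ≤ |f (c' i)| * (|x i / d i| * (|K i| * |y i|)) := by
          gcongr
          exact (hK i).trans (mul_le_mul_of_nonneg_right (le_abs_self _) (abs_nonneg _))
      _ = |f (c' i)| * |K i| * (x i * y i / d i) := by
          rw [← abs_of_nonneg (hterm i)]
          simp only [abs_mul, abs_div]
          ring
      _ ≤ |f (c' i)| * |K i| * ∑ j, x j * y j / d j := by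
          gcongr
          exact Finset.single_le_sum (f := fun j => x j * y j / d j) (fun j _ => hterm j)
            (Finset.mem_univ i)
  have e₄ : |f ν| ≤ |f p| + |k u| + |∑ i, x i * f (c' i) / d i| := by
    rw [hf]
    exact abs_add_three _ _ _
  rw [hquad]
  nlinarith [mul_nonneg hC₁ hsum, mul_nonneg hC₁ (neg_nonneg.2 huu), mul_nonneg hC₂ hpp,
    mul_nonneg hC₂ hsum, mul_nonneg hC₃ hpp, mul_nonneg hC₃ (neg_nonneg.2 huu),
    mul_nonneg hC₃ hsum]

/-- Restricting a theta frame to the vectors of a subspace `V ∋ c i, c' i` that are orthogonal to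
some of the `c i` leaves a theta frame indexed by the remaining indices. -/
theorem exists_restrict [FiniteDimensional ℚ E] (h : IsThetaFrame B c c') {V : Submodule ℚ E}
    (hc : ∀ i, c i ∈ V) (hc' : ∀ i, c' i ∈ V) {κ : Type*} {σ : κ → ι}
    (hσ : Function.Injective σ) {T : Finset ι} (hσT : ∀ j, σ j ∉ T)
    (hTσ : ∀ i, i ∈ T ∨ ∃ j, σ j = i)
    {F : Type*} [AddCommGroup F] [Module ℚ F] (φ : F →ₗ[ℚ] E) (hφ : Function.Injective φ)
    (hrange : ∀ x, x ∈ LinearMap.range φ ↔ x ∈ V ∧ ∀ i ∈ T, B x (c i) = 0) :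
    ∃ d d' : κ → F, IsThetaFrame (B.comp φ φ) d d' ∧ (∀ j, φ (d' j) = c' (σ j)) ∧
      ∀ j x, B (φ (d j)) (φ x) = B (c (σ j)) (φ x) := by
  have hsymm : ∀ a b, B a b = B b a := fun a b => h.symm.eq a b
  let S : Submodule ℚ E := Submodule.span ℚ (c '' T)
  have hSc : S ≤ Submodule.span ℚ (Set.range c) := Submodule.span_mono (Set.image_subset_range _ _)
  have hSV : S ≤ V := Submodule.span_le.2 (by rintro _ ⟨i, -, rfl⟩; exact hc i)
  have hφT : ∀ x, ∀ i ∈ T, B (φ x) (c i) = 0 := fun x => ((hrange _).1 ⟨x, rfl⟩).2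
  have hSφ : ∀ s ∈ S, ∀ x, B s (φ x) = 0 := by
    intro s hs x
    have hle : S ≤ LinearMap.ker (B.flip (φ x)) := Submodule.span_le.2 (by
      rintro _ ⟨i, hi, rfl⟩
      exact (hsymm _ _).trans (hφT x i hi))
    exact hle hs
  have hd : ∀ j, ∃ x s, s ∈ S ∧ φ x = c (σ j) - s := by
    intro j
    obtain ⟨s, hs, hs'⟩ := exists_mem_forall_apply_sub_eq_zero h.symm
      (fun s hs => h.anisotropic (hSc hs)) (c (σ j))
    obtain ⟨x, hx⟩ := (hrange (c (σ j) - s)).2 ⟨sub_mem (hc _) (hSV hs), fun i hi =>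
      (hsymm _ _).trans (hs' _ (Submodule.subset_span ⟨i, hi, rfl⟩))⟩
    exact ⟨x, s, hs, hx⟩
  have hd' : ∀ j, ∃ x, φ x = c' (σ j) := fun j => (hrange _).2 ⟨hc' _, fun i hi =>
    (hsymm _ _).trans (h.ortho i _ fun he => hσT j (he ▸ hi))⟩
  choose d s hs hds using hd
  choose d' hd' using hd'
  have hdB : ∀ j x, B (φ (d j)) (φ x) = B (c (σ j)) (φ x) := by
    intro j x
    rw [hds, map_sub, LinearMap.sub_apply, hSφ _ (hs j), sub_zero]
  refine ⟨d, d', ⟨⟨fun x y => hsymm _ _⟩, fun z hz hz0 => ?_, fun v hv hv0 => ?_,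
    fun i j hij => ?_, fun i j => ?_, fun i => ?_⟩, hd', hdB⟩
  · refine h.pos (φ z) (fun i => ?_) ((map_ne_zero_iff φ hφ).2 hz0)
    rcases hTσ i with hi | ⟨j, rfl⟩
    · exact (hsymm _ _).trans (hφT z i hi)
    · rw [← hdB]
      exact hz j
  · refine h.neg (φ v) ?_ ((map_ne_zero_iff φ hφ).2 hv0)
    have hle : Submodule.span ℚ (Set.range d) ≤
        (Submodule.span ℚ (Set.range c)).comap φ := Submodule.span_le.2 (by
      rintro _ ⟨j, rfl⟩
      rw [SetLike.mem_coe, Submodule.mem_comap, hds]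
      exact sub_mem (Submodule.subset_span ⟨_, rfl⟩) (hSc (hs j)))
    exact hle hv
  · rw [BilinForm.comp_apply, hdB, hd']
    exact h.ortho _ _ (hσ.ne hij)
  · rw [BilinForm.comp_apply, hd', hd']
    exact h.isotropic _ _
  · rw [BilinForm.comp_apply, hdB, hd']
    exact h.pairing_neg _

end IsThetaFrame

end ThetaFrame

theorem ThetaData.IsThetaData.isThetaFrame {ξ : ThetaData} (hξ : ξ.IsThetaData) :
    IsThetaFrame (intForm ξ.M) ξ.c ξ.c' := by
  obtain ⟨hb, hM, -, ⟨P, hPdim, hP⟩, hNdim, hN, ho, hi, hd, -⟩ := hξ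
  simp only [intPair_eq_intForm] at *
  refine ⟨intForm_isSymm hM, fun z hz => ?_, hN, ho, hi, hd⟩
  refine pos_of_orthogonal_of_finrank (intForm_isSymm hM) hN hP ?_
    (forall_mem_span_range_of_apply_eq_zero hz)
  rw [hPdim, hNdim, Module.finrank_fin_fun]
  omega

theorem IsThetaFrame.isThetaData {ξ : ThetaData} (h : IsThetaFrame (intForm ξ.M) ξ.c ξ.c')
    (hne : ∀ i (g : Fin ξ.n → ℤ), intPair ξ.M (ξ.c' i) (ξ.nu g) ≠ 0) : ξ.IsThetaData := by
  have h1 := h.two_mul_card_le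
  have h2 := h.exists_pos_subspace
  have h3 := finrank_span_eq_card h.linearIndependent_left
  rw [Module.finrank_fin_fun, Fintype.card_fin] at h1 h2
  rw [Fintype.card_fin] at h3
  refine ⟨h1, isSymm_of_intForm h.symm, ?_, ?_, h3, ?_, ?_, ?_, ?_, hne⟩
  all_goals simp only [intPair_eq_intForm]
  exacts [fun x => h.nondegenerate, h2, h.neg, h.ortho, h.isotropic, h.pairing_neg]

section Lattice

/-- Clearing denominators. -/
theorem exists_intCast_mul_eq {ι : Type*} [Finite ι] (f : ι → ℚ) :
    ∃ b : ℤ, b ≠ 0 ∧ ∃ a : ι → ℤ, ∀ i, (b : ℚ) * f i = a i := by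
  obtain ⟨b, hb⟩ := IsLocalization.exist_integer_multiples_of_finite (nonZeroDivisors ℤ) f
  choose a ha using hb
  refine ⟨b, nonZeroDivisors.ne_zero b.2, a, fun i => ?_⟩
  have := ha i
  simp only [Algebra.smul_def] at this
  simpa using this.symm

/-- A linear functional takes discrete values on a coset of `ℤ^n` in `ℚ^n`. -/
theorem exists_one_le_mul_abs_apply {n : ℕ} (f : (Fin n → ℚ) →ₗ[ℚ] ℚ) (a : Fin n → ℚ) :
    ∃ K : ℚ, ∀ g : Fin n → ℤ, f (a + fun t => (g t : ℚ)) ≠ 0 →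
      1 ≤ K * |f (a + fun t => (g t : ℚ))| := by
  obtain ⟨b, hb, m, hm⟩ := exists_intCast_mul_eq
    (fun o : Option (Fin n) => o.elim (f a) fun t => f (Pi.single t 1))
  refine ⟨|(b : ℚ)|, fun g hg => ?_⟩
  have hint : (b : ℚ) * f (a + fun t => (g t : ℚ)) =
      ((m none + ∑ t, g t * m (some t) : ℤ) : ℚ) := by
    rw [map_add, mul_add, LinearMap.pi_apply_eq_sum_univ f fun t => (g t : ℚ), Finset.mul_sum]
    push_cast
    congr 1
    · exact hm none
    · refine Finset.sum_congr rfl fun t _ => ?_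
      rw [← hm (some t), smul_eq_mul, mul_left_comm]
      have hsingle : (fun s => if t = s then (1 : ℚ) else 0) = Pi.single t 1 := by
        ext s
        simp [Pi.single_apply, eq_comm]
      rw [hsingle]
      rfl
  rw [← abs_mul, hint, ← Int.cast_abs]
  have hne := mul_ne_zero (Int.cast_ne_zero.2 hb : (b : ℚ) ≠ 0) hg
  rw [hint, Int.cast_ne_zero] at hne
  exact_mod_cast Int.one_le_abs hne

/-- The intersection of `ℤ^n` with a rational subspace `W` is the image of an integer matrix whose
columns form a `ℚ`-basis of `W`. -/
theorem exists_matrix_lattice_inter {n : ℕ} (W : Submodule ℚ (Fin n → ℚ)) :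
    ∃ (m : ℕ) (A : Matrix (Fin n) (Fin m) ℤ),
      Function.Injective (A.map (Int.cast : ℤ → ℚ)).toLin' ∧
      LinearMap.range (A.map (Int.cast : ℤ → ℚ)).toLin' = W ∧
      ∀ g : Fin n → ℤ, (fun t => (g t : ℚ)) ∈ W → ∃ g' : Fin m → ℤ, A.mulVec g' = g := by
  let ι : (Fin n → ℤ) →ₗ[ℤ] (Fin n → ℚ) := (Algebra.linearMap ℤ ℚ).compLeft (Fin n)
  have hι : ∀ g, ι g = fun t => (g t : ℚ) := fun g => rfl
  let L : Submodule ℤ (Fin n → ℤ) := (W.restrictScalars ℤ).comap ι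
  let e := Module.finBasis ℤ L
  let A : Matrix (Fin n) (Fin (Module.finrank ℤ L)) ℤ := Matrix.of fun t j => (e j : Fin n → ℤ) t
  have hA : ∀ x, (A.map (Int.cast : ℤ → ℚ)).toLin' x = ∑ j, x j • ι (e j) := by
    intro x
    ext t
    simp [A, hι, Matrix.mulVec, dotProduct, mul_comm]
  have hg : ∀ g : Fin n → ℤ, ι g ∈ W → ∃ g', A.mulVec g' = g := by
    intro g hgW
    refine ⟨e.repr ⟨g, hgW⟩, ?_⟩
    have h := congrArg (Subtype.val) (e.sum_repr ⟨g, hgW⟩)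
    simp only [Submodule.coe_sum, Submodule.coe_smul] at h
    conv_rhs => rw [← h]
    ext t
    simp [A, Matrix.mulVec, dotProduct, mul_comm]
  refine ⟨_, A, ?_, ?_, hg⟩
  · have hker : LinearMap.ker (ι.comp L.subtype) = ⊥ := by
      refine LinearMap.ker_eq_bot.2 fun x y hxy => Subtype.ext (funext fun t => ?_)
      have := congrFun hxy t
      simpa [hι] using this
    have hli := e.linearIndependent.map' _ hker
    rw [LinearIndependent.iff_fractionRing ℤ ℚ, Fintype.linearIndependent_iff] at hli
    rw [← LinearMap.ker_eq_bot, LinearMap.ker_eq_bot']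
    intro x hx
    exact funext (hli x ((hA x).symm.trans hx))
  · apply le_antisymm
    · rintro _ ⟨x, rfl⟩
      rw [hA]
      exact Submodule.sum_mem _ fun j _ => Submodule.smul_mem _ _ (e j).2
    · intro x hx
      obtain ⟨b, hb, a, ha⟩ := exists_intCast_mul_eq x
      have hbx : ι a = (b : ℚ) • x := funext fun t => (ha t).symm
      obtain ⟨g', hg'⟩ := hg a (hbx ▸ Submodule.smul_mem _ _ hx)
      refine ⟨(b : ℚ)⁻¹ • fun j => (g' j : ℚ), ?_⟩
      have hmul : (A.map (Int.cast : ℤ → ℚ)).toLin' (fun j => (g' j : ℚ)) = ι a := by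
        rw [← hg']
        ext t
        simp [hι, Matrix.mulVec, dotProduct]
      rw [map_smul, hmul, hbx, inv_smul_smul₀ (Int.cast_ne_zero.2 hb)]

end Lattice

section Summability

theorem summable_exp_neg_mul_abs_int {δ : ℝ} (hδ : 0 < δ) :
    Summable fun m : ℤ => Real.exp (-δ * |(m : ℝ)|) := by
  have h : Summable fun m : ℕ => Real.exp (-δ * m) := by
    simpa [mul_comm] using Real.summable_exp_nat_mul_iff.2 (neg_neg_of_pos hδ)
  exact Summable.of_nat_of_neg (by simpa using h) (by simpa using h)

theorem summable_exp_neg_mul_sum_abs {δ : ℝ} (hδ : 0 < δ) (n : ℕ) :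
    Summable fun g : Fin n → ℤ => Real.exp (-δ * ∑ t, |(g t : ℝ)|) := by
  induction n with
  | zero => exact .of_finite
  | succ n ih =>
    rw [← (Fin.consEquiv fun _ : Fin (n + 1) => ℤ).summable_iff]
    refine ((summable_exp_neg_mul_abs_int hδ).mul_of_nonneg ih
      (fun _ => (Real.exp_pos _).le) (fun _ => (Real.exp_pos _).le)).congr fun p => ?_
    rw [← Real.exp_add, ← mul_add]
    simp [Fin.sum_univ_succ, Fin.consEquiv]

theorem pow_mul_exp_neg_le {ε : ℝ} (hε : 0 < ε) (k : ℕ) {x : ℝ} (hx : 0 ≤ x) :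
    x ^ k * Real.exp (-ε * x) ≤ k.factorial / ε ^ k := by
  have h := Real.pow_div_factorial_le_exp (ε * x) (by positivity) k
  rw [neg_mul, Real.exp_neg, ← div_eq_mul_inv, div_le_div_iff₀ (Real.exp_pos _) (by positivity)]
  rw [div_le_iff₀ (by positivity), mul_pow] at h
  linarith

/-- Polynomial growth times exponential decay in a quantity that controls the coordinates is
summable over `ℤ^n`. -/
theorem summable_of_le_pow_mul_exp {n : ℕ} {F X : (Fin n → ℤ) → ℝ} {A D ε : ℝ} {k : ℕ}
    (hF : ∀ g, 0 ≤ F g) (hA : 0 ≤ A) (hD : 0 < D) (hε : 0 < ε)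
    (h : ∀ g, F g ≠ 0 → F g ≤ A * (X g ^ k * Real.exp (-ε * X g)) ∧ 0 ≤ X g ∧
      ∑ t, |(g t : ℝ)| ≤ D * X g) :
    Summable F := by
  refine Summable.of_nonneg_of_le hF (fun g => ?_)
    ((summable_exp_neg_mul_sum_abs (δ := ε / 2 / D) (by positivity) n).mul_left
      (A * (k.factorial / (ε / 2) ^ k)))
  by_cases h0 : F g = 0
  · rw [h0]
    positivity
  obtain ⟨h1, h2, h3⟩ := h g h0
  refine h1.trans ?_
  rw [mul_assoc]
  refine mul_le_mul_of_nonneg_left ?_ hA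
  rw [show -ε * X g = -(ε / 2) * X g + -(ε / 2) * X g by ring, Real.exp_add, ← mul_assoc]
  refine mul_le_mul (pow_mul_exp_neg_le (half_pos hε) k h2) (Real.exp_le_exp.2 ?_)
    (Real.exp_pos _).le (by positivity)
  rw [neg_mul, neg_mul, neg_le_neg_iff, div_mul_eq_mul_div, div_le_iff₀ hD]
  calc ε / 2 * ∑ t, |(g t : ℝ)| ≤ ε / 2 * (D * X g) := by gcongr
    _ = ε / 2 * X g * D := by ring

end Summability

section RestrictedTheta

theorem abs_sgn_le_one (x : ℚ) : |sgn x| ≤ 1 := by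
  unfold sgn
  split_ifs <;> norm_num

theorem mul_nonpos_of_sgn_ne {x y : ℚ} (h : sgn x ≠ sgn y) : x * y ≤ 0 := by
  by_contra! hxy
  refine h ?_
  rcases pos_and_pos_or_neg_and_neg_of_mul_pos hxy with ⟨hx, hy⟩ | ⟨hx, hy⟩
  · simp [sgn, hx, hy]
  · simp [sgn, hx, hy, hx.not_gt, hy.not_gt]

namespace ThetaData

variable (ξ : ThetaData) (V : Submodule ℚ (Fin ξ.n → ℚ)) (T : Finset (Fin ξ.b))

theorem norm_exp_quadratic (q : ℚ) (τ : ℂ) :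
    ‖Complex.exp (2 * (Real.pi : ℂ) * Complex.I * ((q / 2 : ℚ) : ℂ) * τ)‖ =
      Real.exp (-(Real.pi * τ.im) * q) := by
  rw [Complex.norm_exp]
  congr 1
  have : (2 * (Real.pi : ℂ) * Complex.I * ((q / 2 : ℚ) : ℂ) * τ) =
      ((Real.pi * q : ℝ) : ℂ) * (Complex.I * τ) := by
    push_cast
    ring
  rw [this, Complex.re_ofReal_mul, Complex.I_mul_re]
  ring

theorem mul_nonpos_of_restrictedTerm_ne_zero (hM : ξ.M.IsSymm) {τ : ℂ} {g : Fin ξ.n → ℤ}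
    (h : ξ.restrictedTerm V T τ g ≠ 0) (i : Fin ξ.b) :
    intForm ξ.M (ξ.c i) (ξ.nu g) * intForm ξ.M (ξ.c' i) (ξ.nu g) ≤ 0 := by
  unfold restrictedTerm at h
  split_ifs at h with hcond
  · by_cases hi : i ∈ T
    · have h0 := hcond.2 i hi
      rw [intPair_eq_intForm, ← (intForm_isSymm hM).eq] at h0
      exact (mul_eq_zero_of_left h0 _).le
    · refine mul_nonpos_of_sgn_ne fun heq => h ?_
      rw [Finset.prod_eq_zero (Finset.mem_compl.2 hi)
        (by rw [intPair_eq_intForm, intPair_eq_intForm, heq, sub_self])]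
      simp
  · exact absurd rfl h

theorem norm_restrictedTerm_le (τ : ℂ) (g : Fin ξ.n → ℤ) :
    ‖ξ.restrictedTerm V T τ g‖ ≤ 2 ^ Tᶜ.card *
      (∏ j, |(intForm ξ.M (ξ.alpha j) (ξ.nu g) : ℝ)|) *
        Real.exp (-(Real.pi * τ.im) * intForm ξ.M (ξ.nu g) (ξ.nu g)) := by
  unfold restrictedTerm
  split_ifs
  · rw [norm_mul, norm_exp_quadratic]
    simp only [intPair_eq_intForm]
    gcongr
    rw [← Complex.ofReal_ratCast, Complex.norm_real, Real.norm_eq_abs]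
    push_cast
    rw [abs_mul, Finset.abs_prod, Finset.abs_prod]
    gcongr
    rw [← Finset.prod_const]
    refine Finset.prod_le_prod (fun _ _ => abs_nonneg _) fun i _ => ?_
    have h : ∀ x y : ℚ, |sgn x - sgn y| ≤ 2 := fun x y =>
      (abs_sub _ _).trans (by linarith [abs_sgn_le_one x, abs_sgn_le_one y])
    exact_mod_cast h _ _
  · rw [norm_zero]
    positivity

variable {ξ}

theorem IsThetaData.summable_norm_restrictedTerm (hξ : ξ.IsThetaData) {τ : ℂ} (hτ : 0 < τ.im) :
    Summable fun g : Fin ξ.n → ℤ => ‖ξ.restrictedTerm V T τ g‖ := by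
  have hframe := hξ.isThetaFrame
  have hK := fun i => exists_one_le_mul_abs_apply (intForm ξ.M (ξ.c' i)) ξ.nubar
  choose K hK using hK
  have hK' : ∀ g i, 1 ≤ K i * |intForm ξ.M (ξ.c' i) (ξ.nu g)| := fun g i =>
    hK i g (by rw [← intPair_eq_intForm]; exact hξ.2.2.2.2.2.2.2.2.2 i g)
  choose C hC0 hC using fun j => hframe.exists_abs_apply_le K (intForm ξ.M (ξ.alpha j))
  choose D hD0 hD using fun t => hframe.exists_abs_apply_le K
    (LinearMap.proj t : (Fin ξ.n → ℚ) →ₗ[ℚ] ℚ)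
  let X : (Fin ξ.n → ℤ) → ℚ := fun g => 1 + intForm ξ.M (ξ.nu g) (ξ.nu g)
  let D' : ℚ := 1 + ∑ t, (D t + |ξ.nubar t|)
  have hD' : 0 < D' := add_pos_of_pos_of_nonneg one_pos
    (Finset.sum_nonneg fun t _ => add_nonneg (hD0 t) (abs_nonneg _))
  refine summable_of_le_pow_mul_exp (X := fun g => (X g : ℝ)) (D := D') (ε := Real.pi * τ.im)
    (k := ξ.k) (A := 2 ^ Tᶜ.card * (∏ j, (C j : ℝ)) * Real.exp (Real.pi * τ.im))
    (fun g => norm_nonneg _) ?_ (by exact_mod_cast hD') (by positivity) fun g hg => ?_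
  · have : ∀ j, (0 : ℝ) ≤ C j := fun j => by exact_mod_cast hC0 j
    have := Finset.prod_nonneg fun j (_ : j ∈ Finset.univ) => this j
    positivity
  have hcone := ξ.mul_nonpos_of_restrictedTerm_ne_zero V T hξ.2.1 (norm_ne_zero_iff.1 hg)
  obtain ⟨_, -, h0⟩ := hframe.exists_abs_apply_le K 0
  have hX : 1 ≤ X g := le_add_of_nonneg_right (h0 _ hcone (hK' g)).1
  refine ⟨(ξ.norm_restrictedTerm_le V T τ g).trans ?_, ?_, ?_⟩
  · have hprod : ∏ j, |(intForm ξ.M (ξ.alpha j) (ξ.nu g) : ℝ)| ≤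
        (∏ j, (C j : ℝ)) * (X g : ℝ) ^ ξ.k := by
      calc ∏ j, |(intForm ξ.M (ξ.alpha j) (ξ.nu g) : ℝ)| ≤ ∏ j, (C j * X g : ℝ) :=
            Finset.prod_le_prod (fun _ _ => abs_nonneg _) fun j _ => by
              exact_mod_cast (hC j _ hcone (hK' g)).2
        _ = _ := by simp [Finset.prod_mul_distrib]
    have hexp : Real.exp (-(Real.pi * τ.im) * intForm ξ.M (ξ.nu g) (ξ.nu g)) =
        Real.exp (Real.pi * τ.im) * Real.exp (-(Real.pi * τ.im) * X g) := by
      rw [← Real.exp_add]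
      congr 1
      simp only [X]
      push_cast
      ring
    rw [hexp]
    calc _ ≤ 2 ^ Tᶜ.card * ((∏ j, (C j : ℝ)) * (X g : ℝ) ^ ξ.k) *
          (Real.exp (Real.pi * τ.im) * Real.exp (-(Real.pi * τ.im) * X g)) := by gcongr
      _ = _ := by ring
  · exact_mod_cast zero_le_one.trans hX
  · have hcoord : ∀ t, |(g t : ℚ)| ≤ (D t + |ξ.nubar t|) * X g := by
      intro t
      have h1 : |ξ.nu g t| ≤ D t * X g := (hD t _ hcone (hK' g)).2
      have h2 : (g t : ℚ) = ξ.nu g t - ξ.nubar t := by simp [nu]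
      rw [h2, add_mul]
      exact (abs_sub _ _).trans
        (add_le_add h1 (le_mul_of_one_le_right (abs_nonneg _) hX))
    have hsum : ∑ t, |(g t : ℚ)| ≤ D' * X g := by
      refine (Finset.sum_le_sum fun t _ => hcoord t).trans ?_
      rw [← Finset.sum_mul]
      exact mul_le_mul_of_nonneg_right (le_add_of_nonneg_left zero_le_one)
        (zero_le_one.trans hX)
    exact_mod_cast hsum

theorem IsThetaData.exists_term_eq_restrictedTerm (hξ : ξ.IsThetaData) (hVc : ∀ i, ξ.c i ∈ V)
    (hVc' : ∀ i, ξ.c' i ∈ V) {g₀ : Fin ξ.n → ℤ} (hg₀V : ξ.nu g₀ ∈ V)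
    (hg₀T : ∀ i ∈ T, intPair ξ.M (ξ.nu g₀) (ξ.c i) = 0) :
    ∃ ζ : ThetaData, ζ.IsThetaData ∧ ∃ e : (Fin ζ.n → ℤ) → (Fin ξ.n → ℤ), Function.Injective e ∧
      (∀ τ, Function.support (ξ.restrictedTerm V T τ) ⊆ Set.range e) ∧
      ∀ τ g, ζ.term τ g = ξ.restrictedTerm V T τ (e g) := by
  simp only [intPair_eq_intForm] at hg₀T
  let B := intForm ξ.M
  let W : Submodule ℚ (Fin ξ.n → ℚ) := V ⊓ ⨅ i ∈ T, LinearMap.ker (B.flip (ξ.c i))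
  have hW : ∀ x, x ∈ W ↔ x ∈ V ∧ ∀ i ∈ T, B x (ξ.c i) = 0 := by
    intro x
    simp [W, Submodule.mem_iInf]
  obtain ⟨m, A, hinj, hrange, hlat⟩ := exists_matrix_lattice_inter W
  let φ := (A.map (Int.cast : ℤ → ℚ)).toLin'
  have hφW : ∀ x, φ x ∈ W := fun x => hrange ▸ LinearMap.mem_range_self φ x
  let σ : Fin Tᶜ.card → Fin ξ.b := fun j => (Tᶜ.equivFin.symm j : Fin ξ.b)
  have hσ : Function.Injective σ := Subtype.val_injective.comp (Equiv.injective _)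
  obtain ⟨d, d', hframe, hd', hd⟩ := hξ.isThetaFrame.exists_restrict hVc hVc' hσ (T := T)
    (fun j => Finset.mem_compl.1 (Tᶜ.equivFin.symm j).2)
    (fun i => or_iff_not_imp_left.2 fun hi =>
      ⟨Tᶜ.equivFin ⟨i, Finset.mem_compl.2 hi⟩, by simp [σ]⟩) φ hinj
    (fun x => by rw [← hW, hrange])
  have hnd : ((intForm ξ.M).comp φ φ).Nondegenerate :=
    .ofSeparatingLeft fun x hx => hframe.nondegenerate hx
  have hα : ∀ j, ∃ a, ∀ x, B (φ a) (φ x) = B (ξ.alpha j) (φ x) := fun j =>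
    ⟨(((intForm ξ.M).comp φ φ).toDual hnd).symm ((B (ξ.alpha j)).comp φ), fun x =>
      BilinForm.apply_toDual_symm_apply (hB := hnd) _ x⟩
  choose a ha using hα
  obtain ⟨ν₀, hν₀⟩ : ξ.nu g₀ ∈ LinearMap.range φ := hrange ▸ (hW _).2 ⟨hg₀V, hg₀T⟩
  let ζ : ThetaData :=
    { n := m, b := Tᶜ.card, k := ξ.k, M := A.transpose * ξ.M * A, c := d, c' := d',
      nubar := ν₀, alpha := a }
  have hM : intForm ζ.M = (intForm ξ.M).comp φ φ := by
    simp only [ζ, intForm, φ]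
    rw [Matrix.toBilin'_comp]
    congr 1
    ext i j
    simp [Matrix.mul_apply]
  have hMapply : ∀ x y, intPair ζ.M x y = B (φ x) (φ y) := fun x y => by
    rw [intPair_eq_intForm, hM, BilinForm.comp_apply]
  have hcast : ∀ g : Fin m → ℤ, φ (fun t => (g t : ℚ)) = fun t => (A.mulVec g t : ℚ) := by
    intro g
    ext t
    simp [φ, Matrix.mulVec, dotProduct]
  let e : (Fin m → ℤ) → (Fin ξ.n → ℤ) := fun g => g₀ + A.mulVec g
  have hnu : ∀ g, φ (ζ.nu g) = ξ.nu (e g) := by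
    intro g
    simp only [nu, ζ, map_add, hν₀, hcast, e]
    ext t
    simp [add_assoc]
  refine ⟨ζ, IsThetaFrame.isThetaData ?_ ?_, e, ?_, ?_, ?_⟩
  · rw [hM]
    exact hframe
  · intro i g
    have := hξ.2.2.2.2.2.2.2.2.2 (σ i) (e g)
    rwa [hMapply, hnu, hd', ← intPair_eq_intForm]
  · intro g g' h
    have hA : A.mulVec g = A.mulVec g' := add_left_cancel h
    have h2 := hinj ((hcast g).trans
      ((congrArg (fun v : Fin ξ.n → ℤ => fun t => (v t : ℚ)) hA).trans (hcast g').symm))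
    exact funext fun t => Int.cast_injective (congrFun h2 t)
  · intro τ g hg
    have hgW : ξ.nu g ∈ W := by
      by_contra hgW
      refine hg (if_neg fun hcond => hgW ((hW _).2 ?_))
      simpa only [intPair_eq_intForm] using hcond
    have hdiff : (fun t => ((g - g₀) t : ℚ)) ∈ W := by
      convert sub_mem hgW ((hW _).2 ⟨hg₀V, hg₀T⟩) using 1
      ext t
      simp [nu]
    obtain ⟨g', hg'⟩ := hlat _ hdiff
    exact ⟨g', by simp [e, hg']⟩
  · intro τ g
    have hcond : ξ.nu (e g) ∈ V ∧ ∀ i ∈ T, intPair ξ.M (ξ.nu (e g)) (ξ.c i) = 0 := by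
      simp only [intPair_eq_intForm]
      exact (hW _).1 (hnu g ▸ hφW _)
    have hprod : ∏ i, (sgn (intPair ζ.M (ζ.c i) (ζ.nu g)) - sgn (intPair ζ.M (ζ.c' i) (ζ.nu g))) =
        ∏ i ∈ Tᶜ, (sgn (intPair ξ.M (ξ.c i) (ξ.nu (e g))) -
          sgn (intPair ξ.M (ξ.c' i) (ξ.nu (e g)))) := by
      rw [← Finset.prod_coe_sort Tᶜ]
      refine Eq.trans (Finset.prod_congr rfl fun i _ => ?_) (Tᶜ.equivFin.symm.prod_comp _)
      rw [hMapply, hMapply, hd, hd', hnu, intPair_eq_intForm, intPair_eq_intForm]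
    have hprodα : ∏ j, intPair ζ.M (ζ.alpha j) (ζ.nu g) =
        ∏ j, intPair ξ.M (ξ.alpha j) (ξ.nu (e g)) :=
      Finset.prod_congr rfl fun j _ => by
        rw [hMapply, ha, hnu, intPair_eq_intForm]
    unfold term restrictedTerm
    rw [if_pos hcond, hprod, hprodα, hMapply, hnu, intPair_eq_intForm]

end ThetaData

end RestrictedTheta

/-- For theta data `ξ`, a linear subspace `V ⊆ Γ ⊗ ℚ` containing all the
`c_i` and `c_i′`, and a subset `T ⊆ {1,…,b}`, the restricted theta series over
`ν ∈ (ν̄ + Γ) ∩ V` with `B(ν, c_i) = 0` for `i ∈ T` converges absolutely on the upper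
half plane, and the resulting function belongs to the algebra `𝓜`. -/
theorem restricted_theta_mem_MM (ξ : ThetaData) (hξ : ξ.IsThetaData)
    (V : Submodule ℚ (Fin ξ.n → ℚ)) (hVc : ∀ i, ξ.c i ∈ V) (hVc' : ∀ i, ξ.c' i ∈ V)
    (T : Finset (Fin ξ.b)) :
    (∀ τ : ℂ, 0 < τ.im →
      Summable fun g : Fin ξ.n → ℤ => ‖ξ.restrictedTerm V T τ g‖) ∧
    (fun τ : UpperHalfPlane => ∑' g : Fin ξ.n → ℤ, ξ.restrictedTerm V T (τ : ℂ) g)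
      ∈ MM := by
  refine ⟨fun τ hτ => hξ.summable_norm_restrictedTerm V T hτ, ?_⟩
  by_cases hne : ∃ g₀, ξ.nu g₀ ∈ V ∧ ∀ i ∈ T, intPair ξ.M (ξ.nu g₀) (ξ.c i) = 0
  · obtain ⟨g₀, hg₀V, hg₀T⟩ := hne
    obtain ⟨ζ, hζ, e, he, hsupp, hterm⟩ :=
      hξ.exists_term_eq_restrictedTerm V T hVc hVc' hg₀V hg₀T
    refine Algebra.subset_adjoin ⟨ζ, 1, hζ, le_rfl, funext fun τ => ?_⟩
    rw [← he.tsum_eq (hsupp _)]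
    simp only [ThetaData.Theta, hterm, Nat.cast_one, div_one]
  · convert zero_mem MM with τ
    simp only [ThetaData.restrictedTerm]
    rw [Pi.zero_apply]
    exact (tsum_congr fun g => if_neg fun h => hne ⟨g, h⟩).trans tsum_zero
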